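/- For the language L₁ = {w ∈ {a,b}* : |w|_b even} with a < b, the set of words of L₁ whose value val_{L₁}(w) is congruent to 1 modulo 3 is a regular language, recognized by a deterministic finite automaton with at most 2·3² = 18 states. -/

import Mathlib

/-- The radix order on words over a totally ordered alphabet. -/
def radixLt {A : Type*} [LinearOrder A] (u v : List A) : Prop :=
  u.length < v.length ∨ (u.length = v.length ∧ List.Lex (· < ·) u v)

/-- The language `L₁` of words over the two-letter alphabet `Fin 2`
(with `0 = a < b = 1`) having an even number of `b`'s. -/
def Lone : Set (List (Fin 2)) := {w | w.count 1 % 2 = 0}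

/-- The value of a word `w` in the abstract numeration system given by `L`. -/
noncomputable def ansVal (L : Set (List (Fin 2))) (w : List (Fin 2)) : ℕ :=
  {v ∈ L | radixLt v w}.ncard

theorem lex_snoc_iff {A : Type*} [LinearOrder A] {x y : A} :
    ∀ {u v : List A}, u.length = v.length →
      (List.Lex (· < ·) (u ++ [x]) (v ++ [y]) ↔ List.Lex (· < ·) u v ∨ u = v ∧ x < y)
  | [], [], _ => by simp [List.cons_lex_cons_iff]
  | a :: u, b :: v, h => by
    have ih := lex_snoc_iff (x := x) (y := y) (u := u) (v := v) (by simpa using h)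
    simp only [List.cons_append, List.cons_lex_cons_iff, ih, List.cons.injEq]
    tauto

theorem radixLt_snoc_iff {A : Type*} [LinearOrder A] {u v : List A} {x y : A} :
    radixLt (u ++ [x]) (v ++ [y]) ↔ radixLt u v ∨ u = v ∧ x < y := by
  unfold radixLt
  by_cases h : u.length = v.length
  · simp only [List.length_append, List.length_singleton, h, lt_irrefl, true_and, false_or,
      lex_snoc_iff h]
  · have : u ≠ v := fun e => h (e ▸ rfl)
    simp [h, this]

theorem radixLt_irrefl {A : Type*} [LinearOrder A] (w : List A) : ¬ radixLt w w := by
  simp only [radixLt, lt_irrefl, true_and, false_or]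
  exact irrefl_of (List.Lex (· < ·)) w

theorem not_radixLt_nil {A : Type*} [LinearOrder A] (v : List A) : ¬ radixLt v [] := by
  rintro (h | ⟨_, h⟩)
  · simp at h
  · exact absurd h (by simp)

theorem nil_radixLt_snoc {A : Type*} [LinearOrder A] (w : List A) (x : A) :
    radixLt [] (w ++ [x]) := by
  simp [radixLt]

theorem finite_setOf_radixLt {A : Type*} [LinearOrder A] [Finite A] (w : List A) :
    {v | radixLt v w}.Finite := by
  refine (List.finite_length_le A w.length).subset ?_
  rintro v (h | ⟨h, _⟩)
  · exact h.le
  · exact h.le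

theorem ansVal_nil (L : Set (List (Fin 2))) : ansVal L [] = 0 := by
  simp [ansVal, not_radixLt_nil]

theorem setOf_radixLt_snoc (w : List (Fin 2)) (x : Fin 2) :
    {v | radixLt v (w ++ [x])} =
      insert [] ((· ++ [0]) '' {v | radixLt v w} ∪ (· ++ [1]) '' {v | radixLt v w} ∪
        {v | v = w ++ [0] ∧ x = 1}) := by
  ext v
  rcases List.eq_nil_or_concat' v with rfl | ⟨u, y, rfl⟩
  · simp [nil_radixLt_snoc]
  · fin_cases y <;> fin_cases x <;> simp [radixLt_snoc_iff, or_comm]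

theorem ncard_setOf_and_eq {A : Type*} (p : Prop) [Decidable p] (a : A) :
    {v | v = a ∧ p}.ncard = if p then 1 else 0 := by
  split_ifs with h <;> simp [h]

/-- Counting all words below `w ++ [x]` by their last letter. -/
theorem ansVal_univ_snoc (w : List (Fin 2)) (x : Fin 2) :
    ansVal Set.univ (w ++ [x]) = 1 + 2 * ansVal Set.univ w + if x = 1 then 1 else 0 := by
  have hf := finite_setOf_radixLt w
  have inj (y : Fin 2) : Function.Injective (fun v : List (Fin 2) => v ++ [y]) :=
    List.append_left_injective [y]
  have ht : {v | v = w ++ [0] ∧ x = 1}.Finite := (Set.finite_singleton _).subset fun _ h => h.1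
  simp only [ansVal, Set.mem_univ, true_and]
  rw [setOf_radixLt_snoc, Set.ncard_insert_of_notMem (by simp)
      (((hf.image _).union (hf.image _)).union ht),
    Set.ncard_union_eq _ ((hf.image _).union (hf.image _)) ht,
    Set.ncard_union_eq _ (hf.image _) (hf.image _),
    Set.ncard_image_of_injective _ (inj 0), Set.ncard_image_of_injective _ (inj 1),
    ncard_setOf_and_eq]
  · ring
  · rw [Set.disjoint_left]
    rintro _ ⟨u, _, rfl⟩ ⟨v, _, h⟩
    simp at h
  · rw [Set.disjoint_left]
    rintro _ (⟨u, hu, rfl⟩ | ⟨u, hu, rfl⟩) ⟨h, _⟩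
    · obtain rfl : u = w := by simpa using h
      exact radixLt_irrefl _ hu
    · simp at h

theorem snoc_mem_Lone (w : List (Fin 2)) (x : Fin 2) :
    w ++ [x] ∈ Lone ↔ (w ∈ Lone ↔ x = 0) := by
  fin_cases x <;> (simp [Lone]; try omega)

open Classical in
/-- The unique extension of a word by one letter that lies in `Lone`. -/
noncomputable def parityComplete (v : List (Fin 2)) : List (Fin 2) :=
  v ++ [if v ∈ Lone then 0 else 1]

theorem parityComplete_injective : Function.Injective parityComplete := fun u v h => by
  simpa [parityComplete] using congrArg List.dropLast h

open Classical in
theorem setOf_Lone_radixLt_snoc (w : List (Fin 2)) (x : Fin 2) :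
    {v ∈ Lone | radixLt v (w ++ [x])} =
      insert [] (parityComplete '' {v | radixLt v w} ∪
        {v | v = w ++ [0] ∧ (x = 1 ∧ w ∈ Lone)}) := by
  ext v
  rcases List.eq_nil_or_concat' v with rfl | ⟨u, y, rfl⟩
  · simp [nil_radixLt_snoc, Lone]
  · have key : u ++ [y] ∈ parityComplete '' {v | radixLt v w} ↔
        u ++ [y] ∈ Lone ∧ radixLt u w := by
      rw [snoc_mem_Lone]
      constructor
      · rintro ⟨v, hv, h⟩
        obtain ⟨rfl, rfl⟩ : v = u ∧ (if v ∈ Lone then 0 else 1) = y := by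
          simpa [parityComplete] using h
        exact ⟨by simp, hv⟩
      · rintro ⟨h, hu⟩
        refine ⟨u, hu, ?_⟩
        by_cases hL : u ∈ Lone <;> (simp [parityComplete, hL] at h ⊢; omega)
    rw [Set.mem_insert_iff, Set.mem_union, key]
    fin_cases y <;> fin_cases x <;>
      (simp [radixLt_snoc_iff, snoc_mem_Lone]; try grind)

open Classical in
/-- Counting the words of `Lone` below `w ++ [x]` by their prefix of colength one. -/
theorem ansVal_Lone_snoc (w : List (Fin 2)) (x : Fin 2) :
    ansVal Lone (w ++ [x]) =
      1 + ansVal Set.univ w + if x = 1 ∧ w ∈ Lone then 1 else 0 := by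
  have hf := finite_setOf_radixLt w
  have ht : {v | v = w ++ [0] ∧ (x = 1 ∧ w ∈ Lone)}.Finite :=
    (Set.finite_singleton _).subset fun _ h => h.1
  simp only [ansVal, Set.mem_univ, true_and]
  rw [setOf_Lone_radixLt_snoc, Set.ncard_insert_of_notMem (by simp [parityComplete])
      ((hf.image _).union ht),
    Set.ncard_union_eq _ (hf.image _) ht,
    Set.ncard_image_of_injective _ parityComplete_injective, ncard_setOf_and_eq]
  · ring
  · rw [Set.disjoint_left]
    rintro _ ⟨u, hu, rfl⟩ ⟨h, _⟩
    obtain rfl : u = w := by simpa [parityComplete] using congrArg List.dropLast h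
    exact radixLt_irrefl _ hu

/-- The automaton tracking the parity of the number of `b`'s, the value in `Lone` mod `3`, and the
value in the language of all words mod `3`. -/
def valueDFA : DFA (Fin 2) (ZMod 2 × ZMod 3 × ZMod 3) where
  step s x := (s.1 + if x = 1 then 1 else 0,
    1 + s.2.2 + if x = 1 ∧ s.1 = 0 then 1 else 0,
    1 + 2 * s.2.2 + if x = 1 then 1 else 0)
  start := (0, 0, 0)
  accept := {s | s.1 = 0 ∧ s.2.1 = 1}

theorem mem_Lone_iff_cast (w : List (Fin 2)) : w ∈ Lone ↔ (w.count 1 : ZMod 2) = 0 := by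
  rw [ZMod.natCast_eq_zero_iff, Nat.dvd_iff_mod_eq_zero]
  rfl

theorem valueDFA_eval (w : List (Fin 2)) :
    valueDFA.eval w = ((w.count 1 : ZMod 2), (ansVal Lone w : ZMod 3),
      (ansVal Set.univ w : ZMod 3)) := by
  induction w using List.reverseRecOn with
  | nil => simp [valueDFA, ansVal_nil]
  | append_singleton w x ih =>
    rw [DFA.eval_append_singleton, ih, ansVal_univ_snoc, ansVal_Lone_snoc]
    simp [valueDFA, mem_Lone_iff_cast, List.count_singleton]

/-- The set of words of `L₁` whose value is congruent to `1` mod `3` is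
regular, recognized by a DFA with at most `2·3² = 18` states. -/
theorem Lone_value_mod_three_regular :
    ∃ (Q : Type) (_ : Fintype Q) (M : DFA (Fin 2) Q),
      Fintype.card Q ≤ 18 ∧
      M.accepts = {w | w ∈ Lone ∧ ansVal Lone w % 3 = 1} := by
  refine ⟨ZMod 2 × ZMod 3 × ZMod 3, inferInstance, valueDFA, by simp [ZMod.card], ?_⟩
  ext w
  have h : (ansVal Lone w : ZMod 3) = 1 ↔ ansVal Lone w % 3 = 1 := by
    simpa [Nat.ModEq] using ZMod.natCast_eq_natCast_iff (ansVal Lone w) 1 3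
  rw [DFA.mem_accepts, valueDFA_eval]
  exact and_congr (mem_Lone_iff_cast w).symm h
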